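/- arXiv:1410.3878 — 5 statements merged into one kernel-verified Lean document; each statement's English description precedes it below -/
import Mathlib

section
/- Let n ≥ 1. The congruence action of GL(n,ℂ) on the set of symmetric n×n complex matrices has exactly n+1 orbits; more precisely, the map sending a congruence orbit to the common rank of its elements is a bijection from the set of orbits onto {0, 1, …, n}. -/
open Matrix

/-- The congruence orbit of a symmetric `n × n` complex matrix `X` under the action
`g · X = gᵀ * X * g` of invertible matrices, as a subset of the set of symmetric matrices. -/
def congruenceOrbit (n : ℕ) (X : {X : Matrix (Fin n) (Fin n) ℂ // Xᵀ = X}) :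
    Set {X : Matrix (Fin n) (Fin n) ℂ // Xᵀ = X} :=
  {Y | ∃ g : Matrix (Fin n) (Fin n) ℂ, IsUnit g ∧ gᵀ * X.1 * g = Y.1}

/-- The number of indices in `Fin n` with value less than `r ≤ n` is `r`. -/
lemma Fin.card_subtype_val_lt {n r : ℕ} (hr : r ≤ n) :
    Fintype.card {i : Fin n // (i : ℕ) < r} = r := by
  rw [Fintype.card_subtype, Fin.card_filter_val_lt, min_eq_right hr]

namespace Matrix

variable {ι K : Type*} [Fintype ι] [DecidableEq ι] [Field K]

/-- Congruent matrices have the same rank. -/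
lemma rank_transpose_mul_mul_of_isUnit {g : Matrix ι ι K} (hg : IsUnit g) (A : Matrix ι ι K) :
    (gᵀ * A * g).rank = A.rank := by
  have hdet : IsUnit g.det := (isUnit_iff_isUnit_det g).mp hg
  rw [rank_mul_eq_left_of_isUnit_det g _ hdet,
    rank_mul_eq_right_of_isUnit_det _ _ (by rwa [det_transpose])]

/-- In characteristic different from two, a symmetric matrix is congruent to a diagonal one. -/
lemma IsSymm.exists_isUnit_transpose_mul_mul_eq_diagonal [Invertible (2 : K)] {n : ℕ}
    {A : Matrix (Fin n) (Fin n) K} (hA : A.IsSymm) :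
    ∃ (g : Matrix (Fin n) (Fin n) K) (w : Fin n → K), IsUnit g ∧ gᵀ * A * g = diagonal w := by
  obtain ⟨v, hv⟩ := LinearMap.BilinForm.exists_orthogonal_basis (B := toBilin' A)
    (LinearMap.BilinForm.isSymm_iff.mp (isSymm_toBilin'_iff_isSymm.mpr hA))
  let b := v.reindex (finCongr (Module.finrank_fin_fun K))
  have hb : (toBilin' A).IsOrthoᵢ b := fun i j hij ↦ by
    simpa [b, Function.onFun] using hv (fun h ↦ hij (by simpa using h))
  let e := Pi.basisFun K (Fin n)
  refine ⟨e.toMatrix b, fun i ↦ toBilin' A (b i) (b i), ?_, ?_⟩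
  · let := e.invertibleToMatrix b
    exact isUnit_of_invertible _
  · have hAe : LinearMap.BilinForm.toMatrix e (toBilin' A) = A := by
      rw [LinearMap.BilinForm.toMatrix_basisFun, LinearMap.BilinForm.toMatrix'_toBilin']
    rw [← hAe, LinearMap.BilinForm.toMatrix_mul_basis_toMatrix, hAe]
    ext i j
    rw [LinearMap.BilinForm.toMatrix_apply]
    obtain rfl | hij := eq_or_ne i j
    · rw [diagonal_apply_eq]
    · rw [diagonal_apply_ne _ hij]
      exact hb hij

/-- Over an algebraically closed field, a diagonal matrix is congruent to any diagonal
`0`-`1` matrix with the same number of nonzero diagonal entries. -/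
lemma exists_isUnit_transpose_mul_diagonal_mul_eq [IsAlgClosed K] [DecidableEq K] (w : ι → K)
    (p : ι → Prop) [DecidablePred p] (hp : Fintype.card {i // p i} = Fintype.card {i // w i ≠ 0}) :
    ∃ g : Matrix ι ι K, IsUnit g ∧
      gᵀ * diagonal w * g = diagonal fun i ↦ if p i then 1 else 0 := by
  let τ : {i // p i} ≃ {i // w i ≠ 0} := Fintype.equivOfCardEq hp
  let σ : Equiv.Perm ι := τ.extendSubtype
  have hσ (i : ι) : w (σ i) ≠ 0 ↔ p i :=
    ⟨fun h ↦ by_contra fun hi ↦ τ.extendSubtype_not_mem i hi h,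
      τ.extendSubtype_mem i⟩
  choose s hs using fun i ↦ IsAlgClosed.exists_pow_nat_eq (w (σ i)) two_pos
  have hs0 {i : ι} (hi : p i) : s i ≠ 0 := fun h ↦
    (hσ i).mpr hi (by rw [← hs, h, zero_pow two_ne_zero])
  let c : ι → K := fun i ↦ if p i then (s i)⁻¹ else 1
  have hc (i : ι) : c i ≠ 0 := by
    by_cases hi : p i
    · simpa [c, hi] using hs0 hi
    · simp [c, hi]
  refine ⟨(1 : Matrix ι ι K).submatrix id σ * diagonal c, ?_, ?_⟩
  · refine IsUnit.mul ?_ (isUnit_diagonal.mpr (Pi.isUnit_iff.mpr fun i ↦ (hc i).isUnit))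
    exact (isUnit_submatrix_equiv (Equiv.refl ι) σ).mpr isUnit_one
  · have hw : ((1 : Matrix ι ι K).submatrix id σ)ᵀ * diagonal w * (1 : Matrix ι ι K).submatrix id σ
        = diagonal (w ∘ σ) := by
      ext i j
      obtain rfl | hij := eq_or_ne i j <;> simp [mul_apply, one_apply, diagonal_apply, *]
    calc _ = diagonal c * (((1 : Matrix ι ι K).submatrix id σ)ᵀ * diagonal w *
            (1 : Matrix ι ι K).submatrix id σ) * diagonal c := by
          simp only [transpose_mul, diagonal_transpose, Matrix.mul_assoc]
      _ = _ := by
          rw [hw, diagonal_mul_diagonal, diagonal_mul_diagonal]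
          congr 1
          ext i
          by_cases hi : p i
          · have := hs0 hi
            simp only [c, hi, if_true, Function.comp_apply, ← hs]
            field_simp
          · simpa [c, hi] using (hσ i).not.mpr hi

/-- Over an algebraically closed field of characteristic different from two, a symmetric matrix
is congruent to the diagonal matrix with `A.rank` leading ones. -/
lemma IsSymm.exists_isUnit_transpose_mul_mul_eq [IsAlgClosed K] [Invertible (2 : K)] {n : ℕ}
    {A : Matrix (Fin n) (Fin n) K} (hA : A.IsSymm) :
    ∃ g : Matrix (Fin n) (Fin n) K, IsUnit g ∧
      gᵀ * A * g = diagonal fun i : Fin n ↦ if (i : ℕ) < A.rank then 1 else 0 := by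
  classical
  obtain ⟨g, w, hg, hgw⟩ := hA.exists_isUnit_transpose_mul_mul_eq_diagonal
  have hcard : Fintype.card {i : Fin n // (i : ℕ) < A.rank} = Fintype.card {i // w i ≠ 0} := by
    rw [Fin.card_subtype_val_lt (rank_le_width A), ← rank_diagonal, ← hgw,
      rank_transpose_mul_mul_of_isUnit hg]
  obtain ⟨h, hh, hhw⟩ := exists_isUnit_transpose_mul_diagonal_mul_eq w _ hcard
  refine ⟨g * h, hg.mul hh, ?_⟩
  rw [← hhw, ← hgw]
  simp only [transpose_mul, Matrix.mul_assoc]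

/-- Over an algebraically closed field of characteristic different from two, symmetric matrices
are congruent if and only if they have the same rank. -/
lemma IsSymm.exists_isUnit_transpose_mul_mul_eq_iff_rank_eq [IsAlgClosed K] [Invertible (2 : K)]
    {n : ℕ} {A B : Matrix (Fin n) (Fin n) K} (hA : A.IsSymm) (hB : B.IsSymm) :
    (∃ g : Matrix (Fin n) (Fin n) K, IsUnit g ∧ gᵀ * A * g = B) ↔ A.rank = B.rank := by
  refine ⟨?_, fun hAB ↦ ?_⟩
  · rintro ⟨g, hg, rfl⟩
    exact (rank_transpose_mul_mul_of_isUnit hg A).symm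
  · obtain ⟨g, hg, hgA⟩ := hA.exists_isUnit_transpose_mul_mul_eq
    obtain ⟨h, hh, hhB⟩ := hB.exists_isUnit_transpose_mul_mul_eq
    rw [hAB, ← hhB] at hgA
    have hdet : IsUnit h.det := (isUnit_iff_isUnit_det h).mp hh
    have hh' : h * h⁻¹ = 1 := mul_nonsing_inv h hdet
    refine ⟨g * h⁻¹, hg.mul (isUnit_nonsing_inv_iff.mpr hh), ?_⟩
    calc (g * h⁻¹)ᵀ * A * (g * h⁻¹) = (h⁻¹)ᵀ * (gᵀ * A * g) * h⁻¹ := by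
          simp only [transpose_mul, Matrix.mul_assoc]
      _ = (h * h⁻¹)ᵀ * B * (h * h⁻¹) := by
          rw [hgA]
          simp only [transpose_mul, Matrix.mul_assoc]
      _ = B := by rw [hh', transpose_one, Matrix.one_mul, Matrix.mul_one]

end Matrix

lemma mem_congruenceOrbit_iff_rank_eq {n : ℕ} {X Y : {X : Matrix (Fin n) (Fin n) ℂ // Xᵀ = X}} :
    Y ∈ congruenceOrbit n X ↔ X.1.rank = Y.1.rank :=
  IsSymm.exists_isUnit_transpose_mul_mul_eq_iff_rank_eq X.2 Y.2

lemma congruenceOrbit_eq_iff_rank_eq {n : ℕ} {X Y : {X : Matrix (Fin n) (Fin n) ℂ // Xᵀ = X}} :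
    congruenceOrbit n X = congruenceOrbit n Y ↔ X.1.rank = Y.1.rank := by
  refine ⟨fun h ↦ ?_, fun h ↦ ?_⟩
  · rw [← mem_congruenceOrbit_iff_rank_eq, h, mem_congruenceOrbit_iff_rank_eq]
  · ext Z
    rw [mem_congruenceOrbit_iff_rank_eq, mem_congruenceOrbit_iff_rank_eq, h]

/-- The congruence action of `GL(n, ℂ)` on symmetric `n × n` complex matrices
(with `n ≥ 1`) has exactly `n + 1` orbits: the map sending an orbit to the common rank of its
elements is a bijection from the set of orbits onto `{0, 1, …, n}`. -/
theorem congruence_orbits_equiv_fin_succ (n : ℕ) (hn : 1 ≤ n) :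
    ∃ e : {S : Set {X : Matrix (Fin n) (Fin n) ℂ // Xᵀ = X} //
            ∃ X, S = congruenceOrbit n X} ≃ Fin (n + 1),
      ∀ (X : {X : Matrix (Fin n) (Fin n) ℂ // Xᵀ = X}),
        ((e ⟨congruenceOrbit n X, X, rfl⟩ : Fin (n + 1)) : ℕ) = X.1.rank := by
  classical
  let rankOf : {S : Set {X : Matrix (Fin n) (Fin n) ℂ // Xᵀ = X} //
      ∃ X, S = congruenceOrbit n X} → Fin (n + 1) :=
    fun S ↦ ⟨S.2.choose.1.rank, Nat.lt_succ_of_le (rank_le_width _)⟩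
  have hrank (X : {X : Matrix (Fin n) (Fin n) ℂ // Xᵀ = X}) :
      (rankOf ⟨congruenceOrbit n X, X, rfl⟩ : ℕ) = X.1.rank := by
    have hX : ∃ Y, congruenceOrbit n X = congruenceOrbit n Y := ⟨X, rfl⟩
    exact (congruenceOrbit_eq_iff_rank_eq.mp hX.choose_spec).symm
  refine ⟨Equiv.ofBijective rankOf ⟨?_, fun r ↦ ?_⟩, hrank⟩
  · rintro ⟨_, X, rfl⟩ ⟨_, Y, rfl⟩ h
    rw [Fin.ext_iff, hrank, hrank] at h
    exact Subtype.ext (congruenceOrbit_eq_iff_rank_eq.mpr h)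
  · refine ⟨⟨_, ⟨diagonal fun i : Fin n ↦ if (i : ℕ) < r then 1 else 0, diagonal_transpose _⟩, rfl⟩, ?_⟩
    rw [Fin.ext_iff, hrank, rank_diagonal]
    simpa using Fin.card_subtype_val_lt (Nat.le_of_lt_succ r.2)
end

section
/- Let n ≥ 1 and 0 ≤ k ≤ n. The closure, in the topological space Matrix (Fin n) (Fin n) ℂ, of the set {X : Xᵀ = X and rank X = k} equals the set {X : Xᵀ = X and rank X ≤ k}. -/
open Matrix

open Filter Topology

/-- Every symmetric matrix over a field in which `2` is invertible is congruent to a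
diagonal matrix. -/
theorem Matrix.IsSymm.exists_eq_transpose_mul_diagonal_mul {K : Type*} [Field K]
    [Invertible (2 : K)] {n : ℕ} {X : Matrix (Fin n) (Fin n) K} (hX : X.IsSymm) :
    ∃ (P : Matrix (Fin n) (Fin n) K) (w : Fin n → K),
      IsUnit P.det ∧ X = Pᵀ * diagonal w * P := by
  have hB : (Matrix.toBilin' X).IsSymm := by
    rw [LinearMap.BilinForm.isSymm_iff_basis (Pi.basisFun K (Fin n))]
    intro i j
    simpa [Matrix.toBilin'_single] using hX.apply j i
  obtain ⟨v', hv'⟩ := LinearMap.BilinForm.exists_orthogonal_basis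
    (LinearMap.BilinForm.isSymm_iff.1 hB)
  let v := v'.reindex (finCongr (Module.finrank_fin_fun K))
  let e := Pi.basisFun K (Fin n)
  refine ⟨v.toMatrix e, fun i => Matrix.toBilin' X (v i) (v i), ?_, ?_⟩
  · let := v.invertibleToMatrix e
    exact Matrix.isUnit_det_of_invertible _
  · have hD : LinearMap.BilinForm.toMatrix v (Matrix.toBilin' X)
        = diagonal fun i => Matrix.toBilin' X (v i) (v i) := by
      ext i j
      rw [LinearMap.BilinForm.toMatrix_apply]
      obtain rfl | hij := eq_or_ne i j
      · simp
      · rw [diagonal_apply_ne _ hij]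
        simpa [v] using hv' (by simpa using hij)
    rw [← hD, LinearMap.BilinForm.toMatrix_mul_basis_toMatrix,
      LinearMap.BilinForm.toMatrix_basisFun, LinearMap.BilinForm.toMatrix'_toBilin']

/-- The matrix rank is lower semicontinuous. -/
theorem Matrix.isClosed_setOf_rank_le {𝕜 m n : Type*} [NontriviallyNormedField 𝕜]
    [CompleteSpace 𝕜] [Fintype m] [Fintype n] (k : ℕ) :
    IsClosed {X : Matrix m n 𝕜 | X.rank ≤ k} := by
  classical
  let L : Matrix m n 𝕜 →ₗ[𝕜] ((n → 𝕜) →L[𝕜] (m → 𝕜)) :=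
    LinearMap.toContinuousLinearMap.toLinearMap ∘ₗ Matrix.toLin'.toLinearMap
  have hL : Continuous L := L.continuous_of_finiteDimensional
  rw [← isOpen_compl_iff]
  convert (isOpen_setOfPred_nat_le_rank (𝕜 := 𝕜) (E := n → 𝕜) (F := m → 𝕜) (k + 1)).preimage hL
    using 1
  ext X
  have hX : ((L X : (n → 𝕜) →L[𝕜] (m → 𝕜)) : (n → 𝕜) →ₗ[𝕜] (m → 𝕜)).rank = X.rank := by
    rw [Matrix.rank, LinearMap.rank, Module.finrank_eq_rank]
    rfl
  simp only [Set.mem_compl_iff, Set.mem_ofPred_eq, Set.mem_preimage, hX, not_le]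
  norm_cast

/-- A symmetric matrix of rank at most `k ≤ n` is a limit of symmetric matrices of rank `k`. -/
theorem Matrix.IsSymm.mem_closure_rank_eq {𝕜 : Type*} [NontriviallyNormedField 𝕜]
    [Invertible (2 : 𝕜)] {n k : ℕ} {X : Matrix (Fin n) (Fin n) 𝕜} (hX : X.IsSymm)
    (hr : X.rank ≤ k) (hk : k ≤ n) :
    X ∈ closure {Y : Matrix (Fin n) (Fin n) 𝕜 | Yᵀ = Y ∧ Y.rank = k} := by
  classical
  obtain ⟨P, w, hP, rfl⟩ := hX.exists_eq_transpose_mul_diagonal_mul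
  have rank_congr (u : Fin n → 𝕜) :
      (Pᵀ * diagonal u * P).rank = (Finset.univ.filter fun i => u i ≠ 0).card := by
    rw [rank_mul_eq_left_of_isUnit_det _ _ hP,
      rank_mul_eq_right_of_isUnit_det _ _ (by rwa [det_transpose]), rank_diagonal,
      Fintype.card_subtype]
  rw [rank_congr] at hr
  obtain ⟨T, hT, hTk⟩ := Finset.exists_superset_card_eq hr (by simpa using hk)
  let u (ε : 𝕜) (i : Fin n) : 𝕜 := if w i = 0 ∧ i ∈ T then ε else w i
  have hu : Continuous u := by
    refine continuous_pi fun i => ?_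
    simp only [u]
    split_ifs <;> fun_prop
  have hu0 : u 0 = w := by
    ext i
    simp only [u]
    split_ifs with h
    exacts [h.1.symm, rfl]
  have hlim : Tendsto (fun ε => Pᵀ * diagonal (u ε) * P) (𝓝[≠] 0)
      (𝓝 (Pᵀ * diagonal w * P)) := by
    have hc : Continuous fun ε => Pᵀ * diagonal (u ε) * P := by fun_prop
    simpa only [hu0] using (hc.tendsto 0).mono_left nhdsWithin_le_nhds
  refine mem_closure_of_tendsto hlim ?_
  filter_upwards [self_mem_nhdsWithin] with ε hε
  refine ⟨by simp [Matrix.mul_assoc], ?_⟩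
  rw [rank_congr, ← hTk]
  congr 1
  ext i
  have hi : w i ≠ 0 → i ∈ T := fun h => hT (by simpa using h)
  have hε' : ε ≠ 0 := hε
  simp only [u, Finset.mem_filter_univ]
  split_ifs <;> tauto

/-- For `1 ≤ n` and `k ≤ n`, the closure in `Matrix (Fin n) (Fin n) ℂ` of the
set of symmetric matrices of rank exactly `k` is the set of symmetric matrices of rank at
most `k`. -/
theorem closure_symmetric_rank_eq
    (n k : ℕ) (hn : 1 ≤ n) (hk : k ≤ n) :
    closure {X : Matrix (Fin n) (Fin n) ℂ | Xᵀ = X ∧ X.rank = k}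
      = {X : Matrix (Fin n) (Fin n) ℂ | Xᵀ = X ∧ X.rank ≤ k} := by
  refine Set.Subset.antisymm (closure_minimal (fun X hX => ⟨hX.1, hX.2.le⟩) ?_) fun X hX => ?_
  · exact (isClosed_eq (by fun_prop) continuous_id).inter (isClosed_setOf_rank_le k)
  · let : Invertible (2 : ℂ) := invertibleOfNonzero two_ne_zero
    exact IsSymm.mem_closure_rank_eq hX.1 hX.2 hk
end

section
/- Let 0 ≤ k ≤ m ≤ n with 2m ≤ n + k. Then there exists an n×n complex matrix X with Xᵀ = X and rank X = n whose bottom-right m×m submatrix equals the m×m diagonal matrix with first k diagonal entries 1 and remaining entries 0. -/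
open Matrix

/-- The involution of `Fin n` exchanging the first `r` indices with the last `r`, in order. -/
def swapEnds (n r : ℕ) (h : 2 * r ≤ n) : Equiv.Perm (Fin n) :=
  Function.Involutive.toPerm
    (fun i => ⟨if i.1 < r then n - r + i.1 else if n - r ≤ i.1 then i.1 - (n - r) else i.1,
      by split_ifs <;> omega⟩)
    (fun i => by ext; dsimp only; split_ifs <;> omega)

theorem swapEnds_val (n r : ℕ) (h : 2 * r ≤ n) (i : Fin n) :
    (swapEnds n r h i : ℕ) =
      if i.1 < r then n - r + i.1 else if n - r ≤ i.1 then i.1 - (n - r) else i.1 :=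
  rfl

theorem swapEnds_inv (n r : ℕ) (h : 2 * r ≤ n) : (swapEnds n r h)⁻¹ = swapEnds n r h :=
  Function.Involutive.toPerm_symm _

/-- For `k ≤ m ≤ n` with `2 * m ≤ n + k`, there is a symmetric `n × n` complex
matrix of full rank `n` whose bottom-right `m × m` submatrix is the diagonal matrix with the
first `k` diagonal entries equal to `1` and the rest `0`. -/
theorem exists_symmetric_full_rank_with_bottomRight_block
    (k m n : ℕ) (hkm : k ≤ m) (hmn : m ≤ n) (h : 2 * m ≤ n + k) :
    ∃ X : Matrix (Fin n) (Fin n) ℂ, Xᵀ = X ∧ X.rank = n ∧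
      X.submatrix
          (fun i : Fin m => (⟨n - m + i.1, by have := i.2; omega⟩ : Fin n))
          (fun j : Fin m => (⟨n - m + j.1, by have := j.2; omega⟩ : Fin n))
        = Matrix.diagonal (fun i : Fin m => if (i : ℕ) < k then (1 : ℂ) else 0) := by
  have hr : 2 * (m - k) ≤ n := by omega
  refine ⟨(swapEnds n (m - k) hr).permMatrix ℂ, ?_, ?_, ?_⟩
  · rw [Matrix.transpose_permMatrix, swapEnds_inv]
  · rw [Matrix.rank_of_isUnit, Fintype.card_fin]
    rw [Matrix.isUnit_iff_isUnit_det, Matrix.det_permutation]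
    exact ((Equiv.Perm.sign _).isUnit.map (Int.castRingHom ℂ))
  · ext i j
    simp only [Matrix.submatrix_apply, PEquiv.toMatrix_apply, Equiv.toPEquiv_apply, Option.mem_some_iff,
      Matrix.diagonal_apply, Fin.ext_iff, swapEnds_val]
    grind
end

section
/- Let 0 ≤ k ≤ m ≤ n with n + k ≤ 2m. Then: (a) every n×n complex matrix X with Xᵀ = X whose bottom-right m×m submatrix equals the m×m diagonal matrix with first k diagonal entries 1 and remaining entries 0 satisfies rank X ≤ 2(n−m) + k; and (b) there exists such an X with rank X = 2(n−m) + k. -/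
open Matrix

namespace Matrix

variable {ι κ K : Type*} [Fintype κ] [Field K]

/-- The rank of matrices is subadditive. -/
theorem rank_add_le_add_rank [Finite ι] (A B : Matrix ι κ K) :
    (A + B).rank ≤ A.rank + B.rank := by
  have hle : LinearMap.range (A + B).mulVecLin ≤
      LinearMap.range A.mulVecLin ⊔ LinearMap.range B.mulVecLin := by
    rw [mulVecLin_add]
    exact LinearMap.range_add_le _ _
  exact (Submodule.finrank_mono hle).trans (Submodule.finrank_add_le_finrank_add_finrank _ _)

/-- A matrix whose nonzero entries are covered by the rows in `s` and the columns in `t` has rank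
at most `s.card + t.card`. -/
theorem rank_le_card_add_card_of_forall_notMem [Fintype ι] (A : Matrix ι κ K) (s : Finset ι)
    (t : Finset κ) (hA : ∀ i ∉ s, ∀ j ∉ t, A i j = 0) : A.rank ≤ s.card + t.card := by
  classical
  let B : Matrix ι κ K := of fun i j => if i ∈ s then A i j else 0
  let C : Matrix ι κ K := of fun i j => if i ∈ s then 0 else A i j
  have hsum : A = B + C := by
    ext i j
    by_cases hi : i ∈ s <;> simp [B, C, hi]
  have hB : B.rank ≤ s.card := by
    refine B.rank_le_card_of_support_subset s (Function.support_subset_iff'.2 fun i hi => ?_)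
    have hi : i ∉ s := hi
    ext j
    simp [B, hi]
  have hC : C.rank ≤ t.card := by
    rw [← rank_transpose]
    refine Cᵀ.rank_le_card_of_support_subset t (Function.support_subset_iff'.2 fun j hj => ?_)
    have hj : j ∉ t := hj
    ext i
    by_cases hi : i ∈ s
    · simp [C, hi]
    · simp [C, hi, hA i hi j hj]
  rw [hsum]
  exact (rank_add_le_add_rank B C).trans (add_le_add hB hC)

end Matrix

/-- For `k ≤ m ≤ n` with `n + k ≤ 2 * m`:
(a) every symmetric `n × n` complex matrix whose bottom-right `m × m` submatrix is the
diagonal matrix with first `k` diagonal entries `1` and the rest `0` has rank at most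
`2 * (n - m) + k`; and (b) some such matrix has rank exactly `2 * (n - m) + k`. -/
theorem symmetric_with_bottomRight_block_rank_le_and_exists_max
    (k m n : ℕ) (hkm : k ≤ m) (hmn : m ≤ n) (h : n + k ≤ 2 * m) :
    (∀ X : Matrix (Fin n) (Fin n) ℂ, Xᵀ = X →
      X.submatrix
          (fun i : Fin m => (⟨n - m + i.1, by have := i.2; omega⟩ : Fin n))
          (fun j : Fin m => (⟨n - m + j.1, by have := j.2; omega⟩ : Fin n))
        = Matrix.diagonal (fun i : Fin m => if (i : ℕ) < k then (1 : ℂ) else 0) →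
      X.rank ≤ 2 * (n - m) + k) ∧
    (∃ X : Matrix (Fin n) (Fin n) ℂ, Xᵀ = X ∧
      X.submatrix
          (fun i : Fin m => (⟨n - m + i.1, by have := i.2; omega⟩ : Fin n))
          (fun j : Fin m => (⟨n - m + j.1, by have := j.2; omega⟩ : Fin n))
        = Matrix.diagonal (fun i : Fin m => if (i : ℕ) < k then (1 : ℂ) else 0) ∧
      X.rank = 2 * (n - m) + k) := by
  have upper : ∀ X : Matrix (Fin n) (Fin n) ℂ,
      X.submatrix
          (fun i : Fin m => (⟨n - m + i.1, by have := i.2; omega⟩ : Fin n))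
          (fun j : Fin m => (⟨n - m + j.1, by have := j.2; omega⟩ : Fin n))
        = Matrix.diagonal (fun i : Fin m => if (i : ℕ) < k then (1 : ℂ) else 0) →
      X.rank ≤ 2 * (n - m) + k := by
    intro X hX
    have hrank := X.rank_le_card_add_card_of_forall_notMem
      {i | (i : ℕ) < n - m + k} {j | (j : ℕ) < n - m} (by
        intro i hi j hj
        simp only [Finset.mem_filter, Finset.mem_univ, true_and, not_lt] at hi hj
        have hij := congrFun (congrFun hX ⟨i - (n - m), by omega⟩) ⟨j - (n - m), by omega⟩
        have hi' : n - m + (i - (n - m)) = (i : ℕ) := by omega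
        have hj' : n - m + (j - (n - m)) = (j : ℕ) := by omega
        have hk : ¬ (i : ℕ) - (n - m) < k := by omega
        simpa only [submatrix_apply, diagonal_apply, hi', hj', hk, if_false, ite_self] using hij)
    rw [Fin.card_filter_val_lt, Fin.card_filter_val_lt] at hrank
    omega
  refine ⟨fun X _ hX => upper X hX, ?_⟩
  let X : Matrix (Fin n) (Fin n) ℂ := of fun i j =>
    if ((i : ℕ) < n - m ∧ (j : ℕ) = i + (n - m) + k) ∨
        ((j : ℕ) < n - m ∧ (i : ℕ) = j + (n - m) + k) ∨
        ((i : ℕ) = j ∧ n - m ≤ (i : ℕ) ∧ (i : ℕ) < n - m + k) then 1 else 0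
  have hX : X.submatrix
      (fun i : Fin m => (⟨n - m + i.1, by have := i.2; omega⟩ : Fin n))
      (fun j : Fin m => (⟨n - m + j.1, by have := j.2; omega⟩ : Fin n))
        = Matrix.diagonal (fun i : Fin m => if (i : ℕ) < k then (1 : ℂ) else 0) := by
    ext i j
    simp only [X, submatrix_apply, of_apply, diagonal_apply, Fin.ext_iff, ← ite_and]
    exact if_congr (by omega) rfl rfl
  refine ⟨X, ?_, hX, (upper X hX).antisymm ?_⟩
  · ext i j
    exact if_congr (by omega) rfl rfl
  -- Matching each of the first `2 * (n - m) + k` rows with its unique nonzero column gives `1`.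
  let partner : Fin (2 * (n - m) + k) → Fin n := fun i =>
    ⟨if (i : ℕ) < n - m then i + (n - m) + k else
      if (i : ℕ) < n - m + k then i else i - (n - m) - k, by split_ifs <;> omega⟩
  have hr : 2 * (n - m) + k ≤ n := by omega
  have hone : X.submatrix (Fin.castLE hr) partner = 1 := by
    ext i j
    simp only [X, partner, submatrix_apply, of_apply, one_apply, Fin.ext_iff, Fin.val_castLE]
    exact if_congr (by split_ifs <;> omega) rfl rfl
  calc 2 * (n - m) + k = (X.submatrix (Fin.castLE hr) partner).rank := by
        rw [hone, rank_one, Fintype.card_fin]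
    _ ≤ X.rank := rank_submatrix_le _ _ _
end

section
/- Let 0 ≤ k ≤ m ≤ n, and let D denote the m×m diagonal matrix with first k diagonal entries 1 and remaining entries 0. Consider the set S of all n×n complex matrices of the form gᵀ * X * g, where g ranges over invertible n×n complex matrices and X ranges over matrices with Xᵀ = X whose bottom-right m×m submatrix equals D. Then the closure of S in the topological space Matrix (Fin n) (Fin n) ℂ equals {Y : Yᵀ = Y and rank Y ≤ min(n, 2(n−m) + k)}. -/
open Matrix

namespace Matrix

variable {n : ℕ}

/-- The diagonal matrix whose first `r` diagonal entries are `1` and whose other entries are `0`. -/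
def diagOnes (n r : ℕ) : Matrix (Fin n) (Fin n) ℂ :=
  diagonal fun i => if (i : ℕ) < r then 1 else 0

theorem rank_diagOnes {r : ℕ} (hr : r ≤ n) : (diagOnes n r).rank = r := by
  classical
  have h := Fintype.card_fin_lt_of_le hr
  rw [diagOnes, rank_diagonal]
  simpa using h

theorem rank_add_le (A B : Matrix (Fin n) (Fin n) ℂ) : (A + B).rank ≤ A.rank + B.rank := by
  have h := LinearMap.rank_add_le A.mulVecLin B.mulVecLin
  rw [← mulVecLin_add] at h
  simp only [LinearMap.rank, ← Module.finrank_eq_rank] at h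
  exact_mod_cast h

theorem isClosed_setOf_rank_le_s7 (r : ℕ) :
    IsClosed {A : Matrix (Fin n) (Fin n) ℂ | A.rank ≤ r} := by
  let f : Matrix (Fin n) (Fin n) ℂ →ₗ[ℂ] ((Fin n → ℂ) →L[ℂ] (Fin n → ℂ)) :=
    (LinearMap.toContinuousLinearMap.toLinearMap).comp (toLin' (R := ℂ)).toLinearMap
  have hf : Continuous f := LinearMap.continuous_of_finiteDimensional f
  have h := (isOpen_setOfPred_nat_le_rank (𝕜 := ℂ) (E := Fin n → ℂ) (F := Fin n → ℂ)
    (r + 1)).preimage hf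
  rw [← isOpen_compl_iff]
  convert h using 1
  ext A
  have hA : ((f A : (Fin n → ℂ) →L[ℂ] (Fin n → ℂ)) : (Fin n → ℂ) →ₗ[ℂ] (Fin n → ℂ)).rank
      = (A.rank : Cardinal) := by
    rw [LinearMap.rank, ← Module.finrank_eq_rank]
    rfl
  simp only [Set.mem_compl_iff, Set.mem_ofPred_eq, Set.mem_preimage, hA]
  norm_cast
  omega

theorem exists_basis_toMatrix_congr_eq_diagonal {A : Matrix (Fin n) (Fin n) ℂ} (hA : Aᵀ = A) :
    ∃ v : Module.Basis (Fin n) ℂ (Fin n → ℂ), ∃ d : Fin n → ℂ,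
      LinearMap.BilinForm.toMatrix v (toBilin' A) = diagonal d := by
  have hs : LinearMap.IsSymm (toBilin' A) := by
    refine ⟨fun x y => ?_⟩
    simp only [RingHom.id_apply, toBilin'_apply']
    rw [dotProduct_mulVec, ← mulVec_transpose, hA, dotProduct_comm]
  obtain ⟨v, hv⟩ := LinearMap.BilinForm.exists_orthogonal_basis hs
  refine ⟨v.reindex (finCongr (by simp)), fun i => toBilin' A (v.reindex (finCongr (by simp)) i)
    (v.reindex (finCongr (by simp)) i), ?_⟩
  ext i j
  rw [LinearMap.BilinForm.toMatrix_apply, diagonal_apply]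
  split_ifs with h
  · rw [h]
  · rw [Module.Basis.reindex_apply, Module.Basis.reindex_apply]
    exact hv (by simpa using h)

theorem exists_congr_diagOnes {A : Matrix (Fin n) (Fin n) ℂ} (hA : Aᵀ = A) :
    ∃ g : Matrix (Fin n) (Fin n) ℂ, IsUnit g ∧ A = gᵀ * diagOnes n A.rank * g := by
  classical
  obtain ⟨v, d, hd⟩ := exists_basis_toMatrix_congr_eq_diagonal hA
  have key (w : Module.Basis (Fin n) ℂ (Fin n → ℂ)) :
      ∃ P : Matrix (Fin n) (Fin n) ℂ, IsUnit P ∧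
        A = Pᵀ * LinearMap.BilinForm.toMatrix w (toBilin' A) * P := by
    let b := Pi.basisFun ℂ (Fin n)
    refine ⟨w.toMatrix b, @isUnit_of_invertible _ _ _ (w.invertibleToMatrix b), ?_⟩
    rw [LinearMap.BilinForm.toMatrix_mul_basis_toMatrix, LinearMap.BilinForm.toMatrix_basisFun,
      LinearMap.BilinForm.toMatrix'_toBilin']
  have hcard : Fintype.card {i // d i ≠ 0} = A.rank := by
    obtain ⟨P, hP, hAP⟩ := key v
    have hdet : IsUnit P.det := (isUnit_iff_isUnit_det P).1 hP
    conv_rhs => rw [hAP]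
    rw [hd, rank_mul_eq_left_of_isUnit_det _ _ hdet,
      rank_mul_eq_right_of_isUnit_det _ _ (by rwa [det_transpose]), rank_diagonal]
  have hle : A.rank ≤ n := A.rank_le_width
  have e : {i : Fin n // (i : ℕ) < A.rank} ≃ {i // d i ≠ 0} :=
    Fintype.equivOfCardEq (by rw [hcard, Fintype.card_fin_lt_of_le hle])
  let σ := e.extendSubtype
  have hσ (i : Fin n) : d (σ i) ≠ 0 ↔ (i : ℕ) < A.rank :=
    ⟨fun h => by_contra fun hi => e.extendSubtype_not_mem i hi h, e.extendSubtype_mem i⟩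
  have hc (i : Fin n) : ∃ c : ℂ, c ≠ 0 ∧ d (σ i) = c * (if (i : ℕ) < A.rank then 1 else 0) * c := by
    by_cases h : d (σ i) = 0
    · exact ⟨1, one_ne_zero, by simp [h, ← hσ i]⟩
    · obtain ⟨c, hc⟩ := IsAlgClosed.exists_eq_mul_self (d (σ i))
      refine ⟨c, ?_, by simp [(hσ i).1 h, hc]⟩
      rintro rfl
      exact h (by simpa using hc)
  choose c hc0 hc using hc
  obtain ⟨P, hP, hAP⟩ := key (v.reindex σ.symm)
  have hdiag : LinearMap.BilinForm.toMatrix (v.reindex σ.symm) (toBilin' A)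
      = diagonal c * diagOnes n A.rank * diagonal c := by
    have : LinearMap.BilinForm.toMatrix (v.reindex σ.symm) (toBilin' A)
        = diagonal fun i => d (σ i) := by
      ext i j
      have := congrFun₂ hd (σ i) (σ j)
      simpa [LinearMap.BilinForm.toMatrix_apply, diagonal_apply] using this
    rw [this, diagOnes, diagonal_mul_diagonal, diagonal_mul_diagonal]
    exact congrArg _ (funext hc)
  refine ⟨diagonal c * P, IsUnit.mul ?_ hP, ?_⟩
  · rw [isUnit_iff_isUnit_det, det_diagonal]
    exact (Finset.prod_ne_zero_iff.2 fun i _ => hc0 i).isUnit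
  · rw [hdiag] at hAP
    rw [transpose_mul, diagonal_transpose]
    simpa only [mul_assoc] using hAP

theorem mem_closure_congr_orbit {X Y : Matrix (Fin n) (Fin n) ℂ} (hX : Xᵀ = X) (hY : Yᵀ = Y)
    (hr : Y.rank ≤ X.rank) :
    Y ∈ closure {Z | ∃ g : Matrix (Fin n) (Fin n) ℂ, IsUnit g ∧ Z = gᵀ * X * g} := by
  obtain ⟨g, hg, hYg⟩ := exists_congr_diagOnes hY
  obtain ⟨h, hh, hXh⟩ := exists_congr_diagOnes hX
  let T (ε : ℂ) : Matrix (Fin n) (Fin n) ℂ := diagonal fun i => if (i : ℕ) < Y.rank then 1 else ε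
  let F (ε : ℂ) : Matrix (Fin n) (Fin n) ℂ := gᵀ * (T ε * diagOnes n X.rank * T ε) * g
  have hT : Continuous T := Continuous.matrix_diagonal <| continuous_pi fun i => by
    split_ifs <;> fun_prop
  have hF : Continuous F := by fun_prop
  have hF0 : F 0 = Y := by
    conv_rhs => rw [hYg]
    simp only [F, T, diagOnes, diagonal_mul_diagonal]
    congr 3
    ext i
    split_ifs <;> first | omega | simp
  have ht : Filter.Tendsto F (nhdsWithin 0 {0}ᶜ) (nhds Y) :=
    hF0 ▸ hF.continuousAt.tendsto.mono_left nhdsWithin_le_nhds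
  refine mem_closure_of_tendsto ht ?_
  filter_upwards [self_mem_nhdsWithin] with ε hε
  have hTu : IsUnit (T ε) := by
    rw [isUnit_iff_isUnit_det, det_diagonal]
    refine (Finset.prod_ne_zero_iff.2 fun i _ => ?_).isUnit
    split_ifs
    exacts [one_ne_zero, hε]
  have hdet : IsUnit h.det := (isUnit_iff_isUnit_det h).1 hh
  have hdiag : diagOnes n X.rank = (h⁻¹)ᵀ * X * h⁻¹ := by
    conv_rhs => rw [hXh]
    rw [mul_assoc, mul_assoc, mul_nonsing_inv _ hdet, mul_one, ← mul_assoc, ← transpose_mul,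
      mul_nonsing_inv _ hdet, transpose_one, one_mul]
  refine ⟨h⁻¹ * T ε * g, ((isUnit_nonsing_inv_iff.2 hh).mul hTu).mul hg, ?_⟩
  simp only [F, hdiag, transpose_mul, T, diagonal_transpose, mul_assoc]

theorem rank_le_of_submatrix_eq_diagonal {k p : ℕ} (hpk : p + k ≤ n)
    {X : Matrix (Fin n) (Fin n) ℂ}
    (hX : ∀ i j : Fin n, p ≤ (i : ℕ) → p ≤ (j : ℕ) →
      X i j = if i = j ∧ (i : ℕ) < p + k then 1 else 0) :
    X.rank ≤ min n (2 * p + k) := by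
  classical
  let P := diagOnes n p
  let Q : Matrix (Fin n) (Fin n) ℂ := diagonal fun i => if (i : ℕ) < p then 0 else 1
  let D : Matrix (Fin n) (Fin n) ℂ :=
    diagonal fun i => if p ≤ (i : ℕ) ∧ (i : ℕ) < p + k then 1 else 0
  have hsplit : X = P * X + Q * X * P + D := by
    ext i j
    simp only [add_apply, P, Q, D, diagOnes, diagonal_mul, mul_diagonal, diagonal_apply]
    by_cases hi : (i : ℕ) < p
    · simp [hi]
    · by_cases hj : (j : ℕ) < p
      · have : i ≠ j := by rintro rfl; exact hi hj
        simp [hi, hj, this]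
      · rw [hX i j (by omega) (by omega)]
        simp only [hi, hj, if_false]
        split_ifs <;> first | omega | simp
  have hP : P.rank = p := rank_diagOnes (by omega)
  have hD : D.rank ≤ k := by
    rw [rank_diagonal, Fintype.card_subtype]
    calc _ ≤ (Finset.Ico p (p + k)).card := by
          refine Finset.card_le_card_of_injOn (fun i : Fin n => (i : ℕ)) (fun i hi => ?_)
            (Fin.val_injective.injOn)
          simpa using hi
      _ = k := by simp
  refine le_min X.rank_le_width ?_
  rw [hsplit]
  have h₁ := rank_add_le (P * X + Q * X * P) D
  have h₂ := rank_add_le (P * X) (Q * X * P)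
  have h₃ := rank_mul_le_left P X
  have h₄ := rank_mul_le_right (Q * X) P
  omega

/-- A symmetric partial permutation matrix: for `i < q` the basis vectors `i` and `s + i` are
paired hyperbolically, those in `[q, s)` have norm one and those from `s + q` on span the kernel. -/
def hyperbolicSlice (n s q : ℕ) : Matrix (Fin n) (Fin n) ℂ :=
  of fun i j =>
    if ((i : ℕ) < q ∧ (j : ℕ) = s + i) ∨ ((j : ℕ) < q ∧ (i : ℕ) = s + j) ∨
      (i = j ∧ q ≤ (i : ℕ) ∧ (i : ℕ) < s) then 1 else 0

theorem transpose_hyperbolicSlice (s q : ℕ) :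
    (hyperbolicSlice n s q)ᵀ = hyperbolicSlice n s q := by
  ext i j
  simp only [hyperbolicSlice, transpose_apply, of_apply, Fin.ext_iff]
  refine if_congr ?_ rfl rfl
  omega

theorem le_rank_hyperbolicSlice {s q : ℕ} (hq : q ≤ s) (hn : s + q ≤ n) :
    s + q ≤ (hyperbolicSlice n s q).rank := by
  have hsq : hyperbolicSlice n s q * hyperbolicSlice n s q = diagOnes n (s + q) := by
    ext i j
    rw [mul_apply, diagOnes, diagonal_apply]
    let τ : Fin n := if hi : (i : ℕ) < q then ⟨s + i, by omega⟩
      else if s ≤ (i : ℕ) then ⟨i - s, by omega⟩ else i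
    have hτ : (τ : ℕ) = if (i : ℕ) < q then s + i else if s ≤ (i : ℕ) then i - s else i := by
      simp only [τ]
      split_ifs <;> rfl
    rw [Finset.sum_eq_single τ]
    · simp only [hyperbolicSlice, of_apply, Fin.ext_iff, hτ]
      split_ifs <;> first | omega | simp
    · intro b _ hb
      rw [Ne, Fin.ext_iff, hτ] at hb
      simp only [hyperbolicSlice, of_apply, Fin.ext_iff]
      split_ifs at hb ⊢ <;> first | omega | simp
    · simp
  calc s + q = (diagOnes n (s + q)).rank := (rank_diagOnes hn).symm
    _ ≤ _ := hsq ▸ rank_mul_le_left _ _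

end Matrix

/-- For `k ≤ m ≤ n`, let `D` be the `m × m` diagonal matrix with first `k`
diagonal entries `1` and the rest `0`, and let `S` be the set of all matrices `gᵀ * X * g`
where `g` is invertible and `X` is symmetric with bottom-right `m × m` submatrix equal to
`D`.  Then the closure of `S` in `Matrix (Fin n) (Fin n) ℂ` is the set of symmetric matrices
of rank at most `min n (2 * (n - m) + k)`. -/
theorem closure_saturation_of_affine_slice
    (k m n : ℕ) (hkm : k ≤ m) (hmn : m ≤ n) :
    closure {Y : Matrix (Fin n) (Fin n) ℂ |
        ∃ g X : Matrix (Fin n) (Fin n) ℂ, IsUnit g ∧ Xᵀ = X ∧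
          X.submatrix
              (fun i : Fin m => (⟨n - m + i.1, by have := i.2; omega⟩ : Fin n))
              (fun j : Fin m => (⟨n - m + j.1, by have := j.2; omega⟩ : Fin n))
            = Matrix.diagonal (fun i : Fin m => if (i : ℕ) < k then (1 : ℂ) else 0) ∧
          Y = gᵀ * X * g}
      = {Y : Matrix (Fin n) (Fin n) ℂ | Yᵀ = Y ∧ Y.rank ≤ min n (2 * (n - m) + k)} := by
  apply Set.Subset.antisymm
  · refine closure_minimal ?_ ((isClosed_eq (by fun_prop) continuous_id).inter
      (isClosed_setOf_rank_le_s7 _))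
    rintro Y ⟨g, X, hg, hX, hD, rfl⟩
    refine ⟨by simp only [transpose_mul, transpose_transpose, hX, mul_assoc], ?_⟩
    refine (rank_mul_le_left _ _).trans ((rank_mul_le_right _ _).trans ?_)
    refine rank_le_of_submatrix_eq_diagonal (by omega) fun i j hi hj => ?_
    have h := congrFun₂ hD ⟨i - (n - m), by omega⟩ ⟨j - (n - m), by omega⟩
    have hi' : n - m + ((i : ℕ) - (n - m)) = i := by omega
    have hj' : n - m + ((j : ℕ) - (n - m)) = j := by omega
    simp only [submatrix_apply, hi', hj', diagonal_apply, Fin.ext_iff] at h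
    rw [h, ← ite_and]
    refine if_congr ?_ rfl rfl
    omega
  · rintro Y ⟨hY, hr⟩
    let q := min (n - m) (m - k)
    have hX := le_rank_hyperbolicSlice (n := n) (s := n - m + k) (q := q) (by omega) (by omega)
    refine closure_mono ?_ (mem_closure_congr_orbit
      (transpose_hyperbolicSlice (n - m + k) q) hY (by omega))
    rintro Z ⟨g, hg, rfl⟩
    refine ⟨g, _, hg, transpose_hyperbolicSlice _ _, ?_, rfl⟩
    ext i j
    simp only [hyperbolicSlice, submatrix_apply, of_apply, diagonal_apply, Fin.ext_iff]
    rw [← ite_and]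
    refine if_congr ?_ rfl rfl
    omega
end
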